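/- There exists N such that for every integer n ≥ N with n not congruent to 3, 5, 24, or 26 (mod 28), the number of isomorphism classes of cyclic (K_{10n+5}, C_5)-designs satisfies NC(10n+5, 5) ≥ 29.7^n. -/

import Mathlib

namespace CCS

/-- A block: a set of edges of the complete graph on `ZMod v`. -/
abbrev Block (v : ℕ) := Finset (Sym2 (ZMod v))

/-- The edge set of the closed tuple `c = (c 0, c 1, …, c (k-1))`. -/
def edgesOf {v k : ℕ} (c : Fin k → ZMod v) : Block v :=
  Finset.image (fun i : Fin k => s(c i, c ⟨(i.1 + 1) % k, Nat.mod_lt _ i.pos⟩)) Finset.univ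

/-- `E` is the edge set of a `k`-cycle on `ZMod v`. Since for `k ≥ 3` the edge set
determines the closed tuple up to rotation and reversal, a `k`-cycle is identified
with its edge set. -/
def IsCycleBlock (v k : ℕ) (E : Block v) : Prop :=
  ∃ c : Fin k → ZMod v, Function.Injective c ∧ E = edgesOf c

/-- The translate `E + z` of a cycle. -/
def translateBlock {v : ℕ} (E : Block v) (z : ZMod v) : Block v :=
  E.image (Sym2.map (· + z))

/-- A `(K_v, C_k)`-design: a set of `k`-cycles whose edge sets partition the edges of `K_v`. -/
def IsDesign (v k : ℕ) (B : Set (Block v)) : Prop :=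
  (∀ E ∈ B, IsCycleBlock v k E) ∧
  ∀ e : Sym2 (ZMod v), ¬ e.IsDiag → ∃! E, E ∈ B ∧ e ∈ E

/-- A cyclic `(K_v, C_k)`-design. -/
def IsCyclicDesign (v k : ℕ) (B : Set (Block v)) : Prop :=
  IsDesign v k B ∧ ∀ E ∈ B, ∀ z : ZMod v, translateBlock E z ∈ B

/-- Two designs are isomorphic if a bijection of `ZMod v` maps one onto the other. -/
def Isomorphic {v : ℕ} (B B' : Set (Block v)) : Prop :=
  ∃ f : ZMod v ≃ ZMod v, B' = (fun E : Block v => E.image (Sym2.map f)) '' B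

/-- `NC v k`: the number of cyclic `(K_v, C_k)`-designs up to isomorphism. -/
noncomputable def NC (v k : ℕ) : ℕ :=
  Nat.card (Quot fun B B' : {B : Set (Block v) // IsCyclicDesign v k B} =>
    Isomorphic B.1 B'.1)

/-- The type of a cycle: the order of its stabilizer under translations. -/
noncomputable def cycleType {v : ℕ} (E : Block v) : ℕ :=
  Nat.card {z : ZMod v // translateBlock E z = E}

/-- The two differences `±(a-b)` arising from an edge `{a,b}`. -/
def edgeDiffs {v : ℕ} : Sym2 (ZMod v) → Multiset (ZMod v) :=
  Sym2.lift ⟨fun a b => {a - b, b - a}, fun a b => by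
    show (a-b) ::ₘ {b-a} = (b-a) ::ₘ {a-b}; exact Multiset.cons_swap _ _ _⟩

/-- The multiset of the `2k` differences arising from the `k` edges of a cycle.
For a cycle of type `d` this is `d` copies of the list `∂C` of partial differences. -/
def fullDiffs {v : ℕ} (E : Block v) : Multiset (ZMod v) :=
  E.val.bind edgeDiffs

/-- The multiset `∂C` of partial differences of a cycle: each difference is counted
with multiplicity equal to its multiplicity among the `2k` edge differences divided
by the type of the cycle. -/
noncomputable def partialDiffs {v : ℕ} (E : Block v) : Multiset (ZMod v) :=
  (fullDiffs E).toFinset.val.bind fun x =>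
    Multiset.replicate ((fullDiffs E).count x / cycleType E) x

/-- A `(K_v, C_k)`-difference system: a set of `k`-cycles whose partial differences
cover every nonzero element of `ZMod v` exactly once. -/
def IsDifferenceSystem (v k : ℕ) (F : Finset (Block v)) : Prop :=
  (∀ E ∈ F, IsCycleBlock v k E) ∧
  ∀ x : ZMod v, (F.val.bind partialDiffs).count x = if x = 0 then 0 else 1

end CCS

namespace CCS

open Finset

section Successor

variable {V : Type*} [DecidableEq V]

/-- Axioms for `N x y` to be the vertex following `x, y` on the 5-cycle through the edge
`{x, y}` of a 5-cycle system. -/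
structure IsSuccessor (N : V → V → V) : Prop where
  ne : ∀ x y, x ≠ y → N x y ≠ y
  period_fst : ∀ x y, x ≠ y →
    N (N y (N x y)) (N (N x y) (N y (N x y))) = x
  period_snd : ∀ x y, x ≠ y → N (N (N x y) (N y (N x y))) x = y

/-- A set of vertices closed under the successor operation. -/
def IsClosedUnder (N : V → V → V) (W : Finset V) : Prop :=
  ∀ x ∈ W, ∀ y ∈ W, x ≠ y → N x y ∈ W

/-- In a 5-cycle system, a proper subsystem has at most two thirds of the vertices. -/
lemma IsSuccessor.card_le {N : V → V → V} (hN : IsSuccessor N) {W W' : Finset V}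
    (hW : IsClosedUnder N W) (hW' : IsClosedUnder N W') (hsub : W ⊆ W') (hne : (W' \ W).Nonempty) :
    W.card ≤ 2 * (W' \ W).card := by
  set X := W' \ W with hX
  have key : (W ×ˢ X).card ≤ ((X ×ˢ X) ×ˢ (univ : Finset Bool)).card := by
    refine card_le_card_of_surjOn
      (fun t => if t.2 then (N t.1.1 t.1.2, N t.1.2 (N t.1.1 t.1.2))
        else (N (N t.1.1 t.1.2) (N t.1.2 (N t.1.1 t.1.2)), t.1.1)) ?_
    rintro ⟨w, x⟩ hwx
    simp only [coe_product, Set.mem_prod, mem_coe] at hwx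
    obtain ⟨hw, hx⟩ := hwx
    have hx' : x ∈ W' ∧ x ∉ W := by simpa [hX] using hx
    have hwx : w ≠ x := fun h => hx'.2 (h ▸ hw)
    have e1 := hN.period_fst w x hwx
    have e2 := hN.period_snd w x hwx
    have n1 := hN.ne w x hwx
    have n2 := hN.ne x _ n1.symm
    have n3 := hN.ne _ _ n2.symm
    have m1 := hW' w (hsub hw) x hx'.1 hwx
    have m2 := hW' x hx'.1 _ m1 n1.symm
    have m3 := hW' _ m1 _ m2 n2.symm
    set p := N w x with hp
    set q := N x p with hq
    set r := N p q with hr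
    have n4 : w ≠ r := e1 ▸ hN.ne q r n3.symm
    by_cases hpW : p ∈ W
    · have hrW : r ∉ W := fun h => hx'.2 (e2 ▸ hW r h w hw n4.symm)
      have hqW : q ∉ W := fun h => hrW (hW p hpW q h n2.symm)
      exact ⟨((q, r), true), by simp [hX, m2, m3, hrW, hqW], by simp [e1, e2]⟩
    · exact ⟨((x, p), false), by simp [hX, hx', m1, hpW], by simp [← hq, ← hr, e1]⟩
  simp only [card_product, card_univ, Fintype.card_bool] at key
  have hpos : 0 < X.card := card_pos.mpr hne
  nlinarith

/-- A 5-cycle system is generated by logarithmically many vertices. -/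
lemma IsSuccessor.exists_generating [Fintype V] [Nonempty V] {N : V → V → V}
    (hN : IsSuccessor N) (k : ℕ) :
    ∃ S : Finset V, S.card ≤ k + 1 ∧ ∀ W, IsClosedUnder N W → S ⊆ W →
      W = univ ∨ 3 ^ k ≤ 2 ^ k * W.card := by
  classical
  induction k with
  | zero =>
    refine ⟨{Classical.arbitrary V}, by simp, fun W _ hS => Or.inr ?_⟩
    simpa [Nat.one_le_iff_ne_zero] using (card_pos.mpr ⟨_, hS (mem_singleton_self _)⟩).ne'
  | succ k ih =>
    obtain ⟨S, hS, h⟩ := ih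
    let C : Finset V := univ.filter fun x => ∀ W, IsClosedUnder N W → S ⊆ W → x ∈ W
    have hC : IsClosedUnder N C := by
      intro x hx y hy hxy
      simp only [C, mem_filter, mem_univ, true_and] at hx hy ⊢
      exact fun W hW hSW => hW x (hx W hW hSW) y (hy W hW hSW) hxy
    have hSC : S ⊆ C := by
      intro x hx
      simp only [C, mem_filter, mem_univ, true_and]
      exact fun W _ hSW => hSW hx
    have hCW : ∀ W, IsClosedUnder N W → S ⊆ W → C ⊆ W := by
      intro W hW hSW x hx
      simp only [C, mem_filter, mem_univ, true_and] at hx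
      exact hx W hW hSW
    by_cases hCu : C = univ
    · exact ⟨S, by lia, fun W hW hSW => Or.inl (univ_subset_iff.mp (hCu ▸ hCW W hW hSW))⟩
    obtain ⟨a, ha⟩ : ∃ a, a ∉ C := by
      by_contra! hall
      exact hCu (eq_univ_iff_forall.mpr hall)
    refine ⟨insert a S, (card_insert_le _ _).trans (by lia), fun W hW hSW => Or.inr ?_⟩
    have haW : a ∈ W := hSW (mem_insert_self _ _)
    have hsub := hCW W hW ((subset_insert _ _).trans hSW)
    have h1 := hN.card_le hC hW hsub ⟨a, mem_sdiff.mpr ⟨haW, ha⟩⟩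
    have h2 := card_sdiff_add_card_eq_card hsub
    have h3 := (h C hC hSC).resolve_left hCu
    have h4 : 3 * C.card ≤ 2 * W.card := by lia
    calc 3 ^ (k + 1) = 3 * 3 ^ k := by ring
      _ ≤ 3 * (2 ^ k * C.card) := by gcongr
      _ = 2 ^ k * (3 * C.card) := by ring
      _ ≤ 2 ^ k * (2 * W.card) := by gcongr
      _ = 2 ^ (k + 1) * W.card := by ring

/-- Automorphisms of a 5-cycle system are determined by their values on a small set. -/
lemma IsSuccessor.exists_determining [Fintype V] [Nonempty V] {N : V → V → V}
    (hN : IsSuccessor N) {k : ℕ}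
    (hk : 2 ^ k * Fintype.card V < 3 ^ k) :
    ∃ S : Finset V, S.card ≤ k + 1 ∧ ∀ σ τ : V ≃ V,
      (∀ x y, x ≠ y → σ (N x y) = N (σ x) (σ y)) → (∀ x y, x ≠ y → τ (N x y) = N (τ x) (τ y)) →
      (∀ x ∈ S, σ x = τ x) → σ = τ := by
  obtain ⟨S, hS, h⟩ := hN.exists_generating k
  refine ⟨S, hS, fun σ τ hσ hτ hst => ?_⟩
  have hW : IsClosedUnder N (univ.filter fun x => σ x = τ x) := by
    intro x hx y hy hxy
    simp only [mem_filter, mem_univ, true_and] at hx hy ⊢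
    rw [hσ x y hxy, hτ x y hxy, hx, hy]
  rcases h _ hW (fun x hx => by simpa using hst x hx) with h | h
  · ext x
    have := mem_univ x
    rw [← h] at this
    simpa using this
  · have : 2 ^ k * (univ.filter fun x => σ x = τ x).card ≤ 2 ^ k * Fintype.card V := by
      gcongr
      exact card_le_univ _
    lia

end Successor

section Blocks

variable {v : ℕ}

lemma mem_edgesOf {c : Fin 5 → ZMod v} {e : Sym2 (ZMod v)} :
    e ∈ edgesOf c ↔ ∃ i, s(c i, c (i + 1)) = e := by
  have h : ∀ i : Fin 5, (⟨(i.1 + 1) % 5, Nat.mod_lt _ i.pos⟩ : Fin 5) = i + 1 := by decide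
  simp [edgesOf, h]

lemma edge_mem_edgesOf (c : Fin 5 → ZMod v) (i : Fin 5) : s(c i, c (i + 1)) ∈ edgesOf c :=
  mem_edgesOf.mpr ⟨i, rfl⟩

lemma edgesOf_rotate (c : Fin 5 → ZMod v) (a : Fin 5) :
    edgesOf (fun i => c (i + a)) = edgesOf c := by
  ext e
  simp only [mem_edgesOf]
  constructor
  · rintro ⟨i, rfl⟩
    exact ⟨i + a, by rw [add_right_comm]⟩
  · rintro ⟨i, rfl⟩
    exact ⟨i - a, by rw [sub_add_cancel, add_right_comm, sub_add_cancel]⟩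

lemma edgesOf_reverse (c : Fin 5 → ZMod v) (a : Fin 5) :
    edgesOf (fun i => c (a - i)) = edgesOf c := by
  ext e
  simp only [mem_edgesOf]
  constructor
  · rintro ⟨i, rfl⟩
    refine ⟨a - (i + 1), ?_⟩
    rw [Sym2.eq_swap, sub_add_eq_sub_sub, sub_add_cancel]
  · rintro ⟨i, rfl⟩
    refine ⟨a - (i + 1), ?_⟩
    rw [Sym2.eq_swap, sub_add_eq_sub_sub a, sub_sub_cancel, add_sub_cancel_right]

lemma image_edgesOf (c : Fin 5 → ZMod v) (f : ZMod v → ZMod v) :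
    (edgesOf c).image (Sym2.map f) = edgesOf (f ∘ c) := by
  ext e
  simp only [mem_image, mem_edgesOf]
  constructor
  · rintro ⟨_, ⟨i, rfl⟩, rfl⟩
    exact ⟨i, rfl⟩
  · rintro ⟨i, rfl⟩
    exact ⟨_, ⟨i, rfl⟩, rfl⟩

lemma translateBlock_edgesOf (c : Fin 5 → ZMod v) (z : ZMod v) :
    translateBlock (edgesOf c) z = edgesOf (fun i => c i + z) :=
  image_edgesOf c _

lemma eq_succ_of_edgesOf_eq {c c' : Fin 5 → ZMod v} (hc : c.Injective) (hc' : c'.Injective)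
    (h : edgesOf c = edgesOf c') (i : Fin 5) (h0 : c i = c' i) (h1 : c (i + 1) = c' (i + 1)) :
    c (i + 1 + 1) = c' (i + 1 + 1) := by
  obtain ⟨j, hj⟩ := mem_edgesOf.mp (h ▸ edge_mem_edgesOf c (i + 1))
  rcases Sym2.eq_iff.mp hj with ⟨h2, h3⟩ | ⟨h2, h3⟩
  · rw [h1] at h2
    rw [← h3, hc' h2]
  · rw [h1] at h3
    have hji : j = i := add_right_cancel (hc' h3)
    subst hji
    have := hc (h0.trans h2)
    revert this
    rw [add_assoc]
    intro this
    exact absurd (left_eq_add.mp this) (by decide)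

/-- A 5-cycle is determined by its edge set and its first two vertices. -/
lemma eq_of_edgesOf_eq {c c' : Fin 5 → ZMod v} (hc : c.Injective) (hc' : c'.Injective)
    (h : edgesOf c = edgesOf c') (h0 : c 0 = c' 0) (h1 : c 1 = c' 1) : c = c' := by
  have h2 : c 2 = c' 2 := eq_succ_of_edgesOf_eq hc hc' h 0 h0 h1
  have h3 : c 3 = c' 3 := eq_succ_of_edgesOf_eq hc hc' h 1 h1 h2
  have h4 : c 4 = c' 4 := eq_succ_of_edgesOf_eq hc hc' h 2 h2 h3
  ext i
  fin_cases i <;> simpa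

lemma IsDesign.exists_cycle {B : Set (Block v)} (hB : IsDesign v 5 B) {x y : ZMod v} (hxy : x ≠ y) :
    ∃ c : Fin 5 → ZMod v, c.Injective ∧ edgesOf c ∈ B ∧ c 0 = x ∧ c 1 = y := by
  obtain ⟨E, ⟨hE, hmem⟩, -⟩ := hB.2 s(x, y) (by simpa using hxy)
  obtain ⟨c, hc, rfl⟩ := hB.1 E hE
  obtain ⟨i, hi⟩ := mem_edgesOf.mp hmem
  rcases Sym2.eq_iff.mp hi with ⟨h1, h2⟩ | ⟨h1, h2⟩
  · exact ⟨fun j => c (j + i), fun a b hab => add_right_cancel (hc hab),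
      by rwa [edgesOf_rotate], by simpa using h1, by simpa [add_comm] using h2⟩
  · exact ⟨fun j => c (i + 1 - j), fun a b hab => sub_right_injective (hc hab),
      by rwa [edgesOf_reverse], by simpa using h2, by simpa using h1⟩

lemma IsDesign.eq_of_mem {B : Set (Block v)} (hB : IsDesign v 5 B) {c c' : Fin 5 → ZMod v}
    (hc : c.Injective) (hc' : c'.Injective) (h : edgesOf c ∈ B) (h' : edgesOf c' ∈ B)
    (h0 : c 0 = c' 0) (h1 : c 1 = c' 1) : c = c' := by
  refine eq_of_edgesOf_eq hc hc' ?_ h0 h1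
  refine (hB.2 s(c 0, c 1) ?_).unique ⟨h, edge_mem_edgesOf c 0⟩ ⟨h', ?_⟩
  · simpa using hc.ne (by decide : (0 : Fin 5) ≠ 1)
  · rw [h0, h1]
    exact edge_mem_edgesOf c' 0

lemma IsDesign.exists_successor {B : Set (Block v)} (hB : IsDesign v 5 B) :
    ∃ N : ZMod v → ZMod v → ZMod v, IsSuccessor N ∧ ∀ σ : ZMod v ≃ ZMod v,
      (∀ E ∈ B, E.image (Sym2.map σ) ∈ B) → ∀ x y, x ≠ y → σ (N x y) = N (σ x) (σ y) := by
  choose! P hinj hmem h0 h1 using fun x y (h : x ≠ y) => hB.exists_cycle h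
  have hP : ∀ c : Fin 5 → ZMod v, c.Injective → edgesOf c ∈ B → P (c 0) (c 1) 2 = c 2 := by
    intro c hc hcB
    have hne : c 0 ≠ c 1 := hc.ne (by decide)
    rw [hB.eq_of_mem (hinj _ _ hne) hc (hmem _ _ hne) hcB (h0 _ _ hne) (h1 _ _ hne)]
  have hPi : ∀ c : Fin 5 → ZMod v, c.Injective → edgesOf c ∈ B →
      ∀ i, P (c i) (c (i + 1)) 2 = c (i + 2) := by
    intro c hc hcB i
    have := hP (fun j => c (j + i)) (fun a b hab => add_right_cancel (hc hab))
      (by rwa [edgesOf_rotate])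
    simpa [add_comm] using this
  refine ⟨fun x y => P x y 2, ⟨?_, ?_, ?_⟩, ?_⟩
  · intro x y h
    conv_rhs => rw [← h1 x y h]
    exact (hinj x y h).ne (by decide)
  · intro x y h
    obtain ⟨c, hc, hcB, rfl, rfl⟩ := hB.exists_cycle h
    have e0 : P (c 0) (c 1) 2 = c 2 := hPi c hc hcB 0
    have e1 : P (c 1) (c 2) 2 = c 3 := hPi c hc hcB 1
    have e2 : P (c 2) (c 3) 2 = c 4 := hPi c hc hcB 2
    have e3 : P (c 3) (c 4) 2 = c 0 := hPi c hc hcB 3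
    simp only [e0, e1, e2, e3]
  · intro x y h
    obtain ⟨c, hc, hcB, rfl, rfl⟩ := hB.exists_cycle h
    have e0 : P (c 0) (c 1) 2 = c 2 := hPi c hc hcB 0
    have e1 : P (c 1) (c 2) 2 = c 3 := hPi c hc hcB 1
    have e2 : P (c 2) (c 3) 2 = c 4 := hPi c hc hcB 2
    have e4 : P (c 4) (c 0) 2 = c 1 := hPi c hc hcB 4
    simp only [e0, e1, e2, e4]
  · intro σ hσ x y h
    obtain ⟨c, hc, hcB, rfl, rfl⟩ := hB.exists_cycle h
    have := hP (σ ∘ c) (σ.injective.comp hc) (by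
      rw [← image_edgesOf]
      exact hσ _ hcB)
    simp only [Function.comp_apply] at this
    simp only [this, hP c hc hcB]

end Blocks

section Classes

variable {v : ℕ}

lemma sym2_image_image (E : Block v) (f g : ZMod v → ZMod v) :
    (E.image (Sym2.map f)).image (Sym2.map g) = E.image (Sym2.map (g ∘ f)) := by
  rw [image_image, Sym2.map_comp]

lemma isomorphic_equivalence :
    Equivalence fun B B' : {B : Set (Block v) // IsCyclicDesign v 5 B} => Isomorphic B.1 B'.1 where
  refl B := ⟨Equiv.refl _, by simp⟩
  symm := by
    rintro B B' ⟨f, hf⟩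
    refine ⟨f.symm, ?_⟩
    rw [hf, Set.image_image]
    simp [sym2_image_image]
  trans := by
    rintro B B' B'' ⟨f, hf⟩ ⟨g, hg⟩
    refine ⟨f.trans g, ?_⟩
    rw [hg, hf, Set.image_image]
    simp [sym2_image_image]

lemma IsCyclicDesign.image_translate {B : Set (Block v)} (hB : IsCyclicDesign v 5 B) (z : ZMod v) :
    (fun E => translateBlock E z) '' B = B := by
  apply Set.Subset.antisymm
  · rintro _ ⟨E, hE, rfl⟩
    exact hB.2 E hE z
  · intro E hE
    refine ⟨translateBlock E (-z), hB.2 E hE _, ?_⟩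
    simp only [translateBlock, sym2_image_image]
    have : ((fun x => x + z) ∘ fun x => x + -z) = (id : ZMod v → ZMod v) := by
      ext x
      simp
    simp [this]

/-- A cyclic design isomorphic to `B` is determined by the automorphism of `B` obtained by
transporting the translation by one. -/
lemma IsCyclicDesign.eq_of_conj_eq [NeZero v] {B B₁ B₂ : Set (Block v)}
    (hB₁ : IsCyclicDesign v 5 B₁) {f g : ZMod v ≃ ZMod v}
    (hf : B₁ = (fun E : Block v => E.image (Sym2.map f)) '' B)
    (hg : B₂ = (fun E : Block v => E.image (Sym2.map g)) '' B)
    (hfg : ∀ x, f.symm (f x + 1) = g.symm (g x + 1)) : B₁ = B₂ := by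
  have hstep : ∀ y, g (f.symm (y + 1)) = g (f.symm y) + 1 := by
    intro y
    have := hfg (f.symm y)
    rw [Equiv.apply_symm_apply] at this
    rw [this, Equiv.apply_symm_apply]
  have hnat : ∀ n : ℕ, g (f.symm n) = n + g (f.symm 0) := by
    intro n
    induction n with
    | zero => simp
    | succ n ih =>
      rw [Nat.cast_succ, hstep, ih]
      ring
  obtain ⟨a, ha⟩ : ∃ a, ∀ x, g x = f x + a := by
    refine ⟨g (f.symm 0), fun x => ?_⟩
    have := hnat (f x).val
    rwa [ZMod.natCast_zmod_val, Equiv.symm_apply_apply] at this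
  have hcomp : (g : ZMod v → ZMod v) = (fun x => x + a) ∘ f := funext ha
  rw [← hB₁.image_translate a, hg, hf, Set.image_image, hcomp]
  simp only [translateBlock, sym2_image_image]

/-- The automorphism of `B` obtained by transporting a translation along an isomorphism. -/
lemma IsCyclicDesign.conj_mem {B B₁ : Set (Block v)}
    (hB₁ : IsCyclicDesign v 5 B₁) {f : ZMod v ≃ ZMod v}
    (hf : B₁ = (fun E : Block v => E.image (Sym2.map f)) '' B) {E : Block v} (hE : E ∈ B) :
    E.image (Sym2.map ((f.trans (Equiv.addRight 1)).trans f.symm)) ∈ B := by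
  have h1 : translateBlock (E.image (Sym2.map f)) 1 ∈ B₁ := hB₁.2 _ (hf ▸ ⟨E, hE, rfl⟩) 1
  rw [hf] at h1
  obtain ⟨E', hE', h2⟩ := h1
  have h3 := congrArg (fun F : Block v => F.image (Sym2.map f.symm)) h2
  simp only [translateBlock, sym2_image_image, Equiv.symm_comp_self, Sym2.map_id, image_id] at h3
  rw [h3] at hE'
  exact hE'

lemma card_isomorphic_le [NeZero v] {k : ℕ} (hk : 2 ^ k * v < 3 ^ k)
    (B : {B : Set (Block v) // IsCyclicDesign v 5 B}) :
    Nat.card {B' : {B : Set (Block v) // IsCyclicDesign v 5 B} // Isomorphic B.1 B'.1} ≤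
      v ^ (k + 1) := by
  obtain ⟨N, hN, hσ⟩ := B.2.1.exists_successor
  obtain ⟨S, hS, hdet⟩ := hN.exists_determining (k := k) (by rwa [ZMod.card])
  choose f hf using fun B' : {B' : {B : Set (Block v) // IsCyclicDesign v 5 B} //
    Isomorphic B.1 B'.1} => B'.2
  have hinj : Function.Injective fun B' (x : S) =>
      (((f B').trans (Equiv.addRight 1)).trans (f B').symm) x := by
    intro B₁ B₂ h
    have := hdet _ _
      (hσ _ fun E hE => B₁.1.2.conj_mem (hf B₁) hE) (hσ _ fun E hE => B₂.1.2.conj_mem (hf B₂) hE)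
      fun x hx => congrFun h ⟨x, hx⟩
    exact Subtype.ext (Subtype.ext (B₁.1.2.eq_of_conj_eq (hf B₁) (hf B₂)
      fun x => by simpa using Equiv.congr_fun this x))
  calc _ ≤ Nat.card (S → ZMod v) := Nat.card_le_card_of_injective _ hinj
    _ = v ^ S.card := by simp
    _ ≤ v ^ (k + 1) := Nat.pow_le_pow_right (NeZero.pos v) hS

/-- The number of cyclic designs is at most the number of isomorphism classes times the
maximal size of a class. -/
lemma card_cyclicDesign_le [NeZero v] {k : ℕ} (hk : 2 ^ k * v < 3 ^ k) :
    Nat.card {B : Set (Block v) // IsCyclicDesign v 5 B} ≤ v ^ (k + 1) * NC v 5 := by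
  classical
  let π := Quot.mk fun B B' : {B : Set (Block v) // IsCyclicDesign v 5 B} => Isomorphic B.1 B'.1
  have : Fintype {B : Set (Block v) // IsCyclicDesign v 5 B} := Fintype.ofFinite _
  have : Fintype (Quot fun B B' : {B : Set (Block v) // IsCyclicDesign v 5 B} =>
    Isomorphic B.1 B'.1) := Fintype.ofFinite _
  rw [NC, Nat.card_eq_fintype_card, Nat.card_eq_fintype_card, ← card_univ]
  refine (card_le_mul_card_image (f := π) univ (v ^ (k + 1)) ?_).trans
    (Nat.mul_le_mul_left _ (card_le_univ _))
  intro q hq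
  obtain ⟨B, -, rfl⟩ := mem_image.mp hq
  refine le_trans (le_of_eq ?_) (card_isomorphic_le hk B)
  rw [Nat.card_eq_fintype_card, Fintype.card_subtype]
  congr 1
  ext B'
  simp only [mem_filter, mem_univ, true_and, π]
  rw [isomorphic_equivalence.quot_mk_eq_iff]
  exact ⟨isomorphic_equivalence.symm, isomorphic_equivalence.symm⟩

end Classes

section Skolem

/-- The pairs `{f k, f k + k}`, for `1 ≤ k ≤ N`, cover the integers from `1` to `2 N`. -/
structure IsSkolem (N : ℕ) (f : ℕ → ℕ) : Prop where
  pos : ∀ k, 1 ≤ k → k ≤ N → 1 ≤ f k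
  le : ∀ k, 1 ≤ k → k ≤ N → f k + k ≤ 2 * N
  cover : ∀ x, 1 ≤ x → x ≤ 2 * N → ∃ k, 1 ≤ k ∧ k ≤ N ∧ (x = f k ∨ x = f k + k)

lemma exists_isSkolem_four_mul (s : ℕ) (hs : 2 ≤ s) : ∃ f, IsSkolem (4 * s) f := by
  let f : ℕ → ℕ := fun k =>
    if k % 2 = 0 then 4 * s + (4 * s + 2 - k) / 2 - 1
    else if k = 1 then s
    else if k = 2 * s - 1 then 2 * s
    else if k = 2 * s + 1 then s - 1
    else if k = 4 * s - 1 then 2 * s + 1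
    else if k < 2 * s then s + (2 * s - 1 - k) / 2 + 1
    else (4 * s - 1 - k) / 2
  refine ⟨f, fun k h1 h2 => ?_, fun k h1 h2 => ?_, fun x h1 h2 => ?_⟩
  · simp only [f]
    split_ifs <;> omega
  · simp only [f]
    split_ifs <;> omega
  · have key : ∀ k, 1 ≤ k → k ≤ 4 * s → (x = f k ∨ x = f k + k) →
      ∃ k, 1 ≤ k ∧ k ≤ 4 * s ∧ (x = f k ∨ x = f k + k) := fun k a b c => ⟨k, a, b, c⟩
    rcases (by omega : x ≤ s - 2 ∨ (3 * s + 1 ≤ x ∧ x ≤ 4 * s - 2) ∨ (s + 2 ≤ x ∧ x ≤ 2 * s - 1) ∨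
      (2 * s + 2 ≤ x ∧ x ≤ 3 * s - 1) ∨ (4 * s ≤ x ∧ x ≤ 6 * s - 1) ∨ 6 * s + 1 ≤ x ∨
      x = s - 1 ∨ x = 3 * s ∨ x = s ∨ x = s + 1 ∨ x = 2 * s ∨ x = 4 * s - 1 ∨ x = 2 * s + 1 ∨
      x = 6 * s) with h | h | h | h | h | h | h | h | h | h | h | h | h | h
    · refine key (4 * s - 1 - 2 * x) (by omega) (by omega) ?_
      simp only [f]
      split_ifs <;> omega
    · refine key (4 * s - 1 - 2 * (4 * s - 1 - x)) (by omega) (by omega) ?_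
      simp only [f]
      split_ifs <;> omega
    · refine key (2 * s - 1 - 2 * (x - s - 1)) (by omega) (by omega) ?_
      simp only [f]
      split_ifs <;> omega
    · refine key (2 * s - 1 - 2 * (3 * s - x)) (by omega) (by omega) ?_
      simp only [f]
      split_ifs <;> omega
    · refine key (4 * s + 2 - 2 * (x + 1 - 4 * s)) (by omega) (by omega) ?_
      simp only [f]
      split_ifs <;> omega
    · refine key (4 * s + 2 - 2 * (8 * s + 1 - x)) (by omega) (by omega) ?_
      simp only [f]
      split_ifs <;> omega
    · refine key (2 * s + 1) (by omega) (by omega) ?_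
      simp only [f]
      split_ifs <;> omega
    · refine key (2 * s + 1) (by omega) (by omega) ?_
      simp only [f]
      split_ifs <;> omega
    · refine key 1 (by omega) (by omega) ?_
      simp only [f, if_true, Nat.one_mod, one_ne_zero, if_false]
      omega
    · refine key 1 (by omega) (by omega) ?_
      simp only [f, if_true, Nat.one_mod, one_ne_zero, if_false]
      omega
    · refine key (2 * s - 1) (by omega) (by omega) ?_
      simp only [f]
      split_ifs <;> omega
    · refine key (2 * s - 1) (by omega) (by omega) ?_
      simp only [f]
      split_ifs <;> omega
    · refine key (4 * s - 1) (by omega) (by omega) ?_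
      simp only [f]
      split_ifs <;> omega
    · refine key (4 * s - 1) (by omega) (by omega) ?_
      simp only [f]
      split_ifs <;> omega

lemma exists_isSkolem_four_mul_add_one (s : ℕ) (hs : 2 ≤ s) : ∃ f, IsSkolem (4 * s + 1) f := by
  let f : ℕ → ℕ := fun k =>
    if k % 2 = 0 then 4 * s + (4 * s + 2 - k) / 2 + 1
    else if k = 1 then s + 1
    else if k = 2 * s - 1 then 2 * s + 2
    else if k = 4 * s + 1 then 2 * s + 1
    else if k < 2 * s then s + (2 * s - 1 - k) / 2 + 2
    else (4 * s + 1 - k) / 2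
  refine ⟨f, fun k h1 h2 => ?_, fun k h1 h2 => ?_, fun x h1 h2 => ?_⟩
  · simp only [f]
    split_ifs <;> omega
  · simp only [f]
    split_ifs <;> omega
  · have key : ∀ k, 1 ≤ k → k ≤ 4 * s + 1 → (x = f k ∨ x = f k + k) →
      ∃ k, 1 ≤ k ∧ k ≤ 4 * s + 1 ∧ (x = f k ∨ x = f k + k) := fun k a b c => ⟨k, a, b, c⟩
    rcases (by omega : x ≤ s ∨ (3 * s + 1 ≤ x ∧ x ≤ 4 * s) ∨ (s + 3 ≤ x ∧ x ≤ 2 * s) ∨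
      (2 * s + 3 ≤ x ∧ x ≤ 3 * s) ∨ (4 * s + 2 ≤ x ∧ x ≤ 6 * s + 1) ∨ 6 * s + 3 ≤ x ∨
      x = s + 1 ∨ x = s + 2 ∨ x = 2 * s + 1 ∨ x = 6 * s + 2 ∨ x = 2 * s + 2 ∨ x = 4 * s + 1)
      with h | h | h | h | h | h | h | h | h | h | h | h
    · refine key (4 * s + 1 - 2 * x) (by omega) (by omega) ?_
      simp only [f]
      split_ifs <;> omega
    · refine key (4 * s + 1 - 2 * (4 * s + 1 - x)) (by omega) (by omega) ?_
      simp only [f]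
      split_ifs <;> omega
    · refine key (2 * s - 1 - 2 * (x - s - 2)) (by omega) (by omega) ?_
      simp only [f]
      split_ifs <;> omega
    · refine key (2 * s - 1 - 2 * (3 * s + 1 - x)) (by omega) (by omega) ?_
      simp only [f]
      split_ifs <;> omega
    · refine key (4 * s + 2 - 2 * (x - 1 - 4 * s)) (by omega) (by omega) ?_
      simp only [f]
      split_ifs <;> omega
    · refine key (4 * s + 2 - 2 * (8 * s + 3 - x)) (by omega) (by omega) ?_
      simp only [f]
      split_ifs <;> omega
    · refine key 1 (by omega) (by omega) ?_
      simp only [f, if_true, Nat.one_mod, one_ne_zero, if_false]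
      omega
    · refine key 1 (by omega) (by omega) ?_
      simp only [f, if_true, Nat.one_mod, one_ne_zero, if_false]
      omega
    · refine key (4 * s + 1) (by omega) (by omega) ?_
      simp only [f]
      split_ifs <;> omega
    · refine key (4 * s + 1) (by omega) (by omega) ?_
      simp only [f]
      split_ifs <;> omega
    · refine key (2 * s - 1) (by omega) (by omega) ?_
      simp only [f]
      split_ifs <;> omega
    · refine key (2 * s - 1) (by omega) (by omega) ?_
      simp only [f]
      split_ifs <;> omega

/-- Skolem sequences of order `N` exist for `N` congruent to `0` or `1` modulo `4`. -/
lemma exists_isSkolem {N : ℕ} (hN : 8 ≤ N) (hmod : N % 4 = 0 ∨ N % 4 = 1) : ∃ f, IsSkolem N f := by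
  rcases hmod with h | h
  · obtain ⟨f, hf⟩ := exists_isSkolem_four_mul (N / 4) (by lia)
    exact ⟨f, by rwa [show 4 * (N / 4) = N by lia] at hf⟩
  · obtain ⟨f, hf⟩ := exists_isSkolem_four_mul_add_one (N / 4) (by lia)
    exact ⟨f, by rwa [show 4 * (N / 4) + 1 = N by lia] at hf⟩

end Skolem

section BaseFamily

variable {n : ℕ} {I : Type*}

/-- The elements of the subgroup of order five of `ZMod (10 n + 5)`. -/
def shortVertex (n : ℕ) (j : Fin 5) : ZMod (10 * n + 5) := ((j.val * (2 * n + 1) : ℕ) : ZMod _)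

lemma shortVertex_add (i j : Fin 5) :
    shortVertex n (i + j) = shortVertex n i + shortVertex n j := by
  simp only [shortVertex, ← Nat.cast_add]
  rw [ZMod.natCast_eq_natCast_iff, Fin.val_add, ← Nat.add_mul,
    show 10 * n + 5 = 5 * (2 * n + 1) by ring]
  exact (Nat.mod_modEq _ 5).mul_right' _

lemma shortVertex_neg (j : Fin 5) : shortVertex n (-j) = -shortVertex n j := by
  have h0 : shortVertex n 0 = 0 := by simp [shortVertex]
  rw [eq_neg_iff_add_eq_zero, ← shortVertex_add, neg_add_cancel, h0]

/-- Base cycles of the full orbits of a cyclic design of order `10 n + 5` whose short orbits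
are the 5-cycles on the cosets of the subgroup of order five. -/
structure IsBaseFamily (c : I → Fin 5 → ZMod (10 * n + 5)) : Prop where
  inj : ∀ t, (c t).Injective
  cover : ∀ d, (∃ t p, d = c t (p + 1) - c t p ∨ d = -(c t (p + 1) - c t p)) ∨
    ∃ j, d = shortVertex n j

/-- The set of cycles developed from a family of base cycles, together with the short cycles. -/
def develop (c : I → Fin 5 → ZMod (10 * n + 5)) : Set (Block (10 * n + 5)) :=
  {E | (∃ t z, E = edgesOf fun p => c t p + z) ∨
    ∃ r z, (r = 1 ∨ r = 2) ∧ E = edgesOf fun p => shortVertex n (r * p) + z}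

/-- The differences of a family of base cycles, followed by the subgroup of order five. -/
def allDiffs (c : I → Fin 5 → ZMod (10 * n + 5)) : (I × Fin 5 × Bool) ⊕ Fin 5 → ZMod (10 * n + 5)
  | .inl (t, p, s) => if s then c t (p + 1) - c t p else -(c t (p + 1) - c t p)
  | .inr j => shortVertex n j

lemma IsBaseFamily.injective_allDiffs [Fintype I] (hI : Fintype.card I = n)
    {c : I → Fin 5 → ZMod (10 * n + 5)} (hc : IsBaseFamily c) : (allDiffs c).Injective := by
  refine ((Fintype.bijective_iff_surjective_and_card _).mpr ⟨fun d => ?_, ?_⟩).1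
  · rcases hc.cover d with ⟨t, p, h | h⟩ | ⟨j, h⟩
    · exact ⟨.inl (t, p, true), by simp [allDiffs, h]⟩
    · exact ⟨.inl (t, p, false), by simp [allDiffs, h]⟩
    · exact ⟨.inr j, h.symm⟩
  · simp [hI]
    ring

lemma sub_eq_or_of_sym2_eq {G : Type*} [AddCommGroup G] {a b a' b' : G} (h : s(a, b) = s(a', b')) :
    (b - a = b' - a' ∧ a = a') ∨ b - a = -(b' - a') := by
  rcases Sym2.eq_iff.mp h with ⟨rfl, rfl⟩ | ⟨rfl, rfl⟩
  · exact Or.inl ⟨rfl, rfl⟩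
  · exact Or.inr (by abel)

lemma shortVertex_diff (r p : Fin 5) :
    shortVertex n (r * (p + 1)) - shortVertex n (r * p) = shortVertex n r := by
  rw [mul_add, mul_one, shortVertex_add, add_sub_cancel_left]

lemma IsBaseFamily.isCyclicDesign [Fintype I] (hI : Fintype.card I = n)
    {c : I → Fin 5 → ZMod (10 * n + 5)} (hc : IsBaseFamily c) :
    IsCyclicDesign (10 * n + 5) 5 (develop c) := by
  have hG := hc.injective_allDiffs hI
  have hS : (shortVertex n).Injective := fun i j h => Sum.inr_injective (hG h)
  refine ⟨⟨?_, fun e he => ?_⟩, ?_⟩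
  · rintro E (⟨t, z, rfl⟩ | ⟨r, z, hr, rfl⟩)
    · exact ⟨_, fun a b h => hc.inj t (add_right_cancel h), rfl⟩
    · refine ⟨_, fun a b h => ?_, rfl⟩
      have := hS (add_right_cancel h)
      clear h
      revert a b
      rcases hr with rfl | rfl <;> decide
  · apply existsUnique_of_exists_of_unique
    · induction e with | _ a b
      have hab : a ≠ b := by simpa using he
      rcases hc.cover (b - a) with ⟨t, p, h | h⟩ | ⟨j, h⟩
      · refine ⟨_, Or.inl ⟨t, a - c t p, rfl⟩, mem_edgesOf.mpr ⟨p, ?_⟩⟩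
        rw [Sym2.eq_iff]
        left
        exact ⟨by abel, by linear_combination -h⟩
      · refine ⟨_, Or.inl ⟨t, b - c t p, rfl⟩, mem_edgesOf.mpr ⟨p, ?_⟩⟩
        rw [Sym2.eq_iff]
        right
        exact ⟨by abel, by linear_combination h⟩
      · have h0 : shortVertex n 0 = 0 := by simp [shortVertex]
        have hj : j ≠ 0 := by
          rintro rfl
          rw [h0, sub_eq_zero] at h
          exact hab h.symm
        rcases (by decide : ∀ j : Fin 5, j ≠ 0 → (j = 1 ∨ j = 2) ∨ (-j = 1 ∨ -j = 2)) j hj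
          with hr | hr
        · refine ⟨_, Or.inr ⟨j, a, hr, rfl⟩, mem_edgesOf.mpr ⟨0, ?_⟩⟩
          rw [mul_zero, zero_add, mul_one, h0, zero_add, ← h, sub_add_cancel]
        · refine ⟨_, Or.inr ⟨-j, b, hr, rfl⟩, mem_edgesOf.mpr ⟨0, ?_⟩⟩
          rw [mul_zero, zero_add, mul_one, h0, zero_add, shortVertex_neg, ← h, Sym2.eq_swap,
            neg_sub, sub_add_cancel]
    · have aux : ∀ t p z r p' z', s(c t p + z, c t (p + 1) + z) ≠
          s(shortVertex n (r * p') + z', shortVertex n (r * (p' + 1)) + z') := by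
        intro t p z r p' z' h
        have h2 : c t (p + 1) - c t p = shortVertex n r ∨
            c t (p + 1) - c t p = shortVertex n (-r) := by
          rw [shortVertex_neg, ← shortVertex_diff r p']
          simpa [add_sub_add_right_eq_sub] using (sub_eq_or_of_sym2_eq h).imp And.left id
        rcases h2 with h2 | h2
        · exact absurd (@hG (.inl (t, p, true)) (.inr r) (by simpa [allDiffs] using h2)) (by simp)
        · exact absurd (@hG (.inl (t, p, true)) (.inr (-r)) (by simpa [allDiffs] using h2)) (by simp)
      rintro E E' ⟨⟨t, z, rfl⟩ | ⟨r, z, hr, rfl⟩, hE⟩ ⟨⟨t', z', rfl⟩ | ⟨r', z', hr', rfl⟩, hE'⟩ <;>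
        obtain ⟨p, rfl⟩ := mem_edgesOf.mp hE <;>
        obtain ⟨p', h⟩ := mem_edgesOf.mp hE'
      · rcases sub_eq_or_of_sym2_eq h with ⟨h1, h2⟩ | h1
        · have := @hG (.inl (t', p', true)) (.inl (t, p, true)) (by simpa [allDiffs] using h1)
          simp only [Sum.inl.injEq, Prod.mk.injEq, and_true] at this
          obtain ⟨rfl, rfl⟩ := this
          rw [add_left_cancel h2]
        · exact absurd (@hG (.inl (t', p', true)) (.inl (t, p, false))
            (by simpa [allDiffs] using h1)) (by simp)
      · exact absurd h.symm (aux _ _ _ _ _ _)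
      · exact absurd h (aux _ _ _ _ _ _)
      · rcases sub_eq_or_of_sym2_eq h with ⟨h1, h2⟩ | h1
        · simp only [add_sub_add_right_eq_sub, shortVertex_diff] at h1
          obtain rfl := hS h1
          have hz : z' = shortVertex n (r' * (p - p')) + z := by
            rw [sub_eq_add_neg, mul_add, mul_neg, shortVertex_add, shortVertex_neg]
            linear_combination h2
          rw [← edgesOf_rotate _ (p - p'), hz]
          congr 1
          ext i
          rw [mul_add, shortVertex_add, add_assoc]
        · simp only [add_sub_add_right_eq_sub, shortVertex_diff, ← shortVertex_neg] at h1
          have := hS h1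
          rcases hr with rfl | rfl <;> rcases hr' with rfl | rfl <;> exact absurd this (by decide)
  · rintro E (⟨t, z, rfl⟩ | ⟨r, z, hr, rfl⟩) w
    · exact Or.inl ⟨t, z + w, by simp only [translateBlock_edgesOf, add_assoc]⟩
    · exact Or.inr ⟨r, z + w, hr, by simp only [translateBlock_edgesOf, add_assoc]⟩

end BaseFamily

section Construction

/-- The residue of `y` modulo `v` is, up to sign, the difference of `a` and `b`. -/
def IsDiffOf (v y a b : ℕ) : Prop :=
  y + a = b ∨ y + a = b + v ∨ y + b = a ∨ y + b = a + v

lemma IsDiffOf.cast {v y a b : ℕ} (h : IsDiffOf v y a b) :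
    (y : ZMod v) = b - a ∨ (y : ZMod v) = -(b - a) := by
  have hv : (v : ZMod v) = 0 := ZMod.natCast_self v
  rcases h with h | h | h | h <;> have h' := congrArg (Nat.cast : ℕ → ZMod v) h <;> push_cast at h'
  · exact Or.inl (by linear_combination h')
  · exact Or.inl (by linear_combination h' + hv)
  · exact Or.inr (by linear_combination h')
  · exact Or.inr (by linear_combination h' + hv)

lemma isBaseFamily_cast {n : ℕ} {I : Type*} {C : I → Fin 5 → ℕ}
    (hlt : ∀ t p, C t p < 10 * n + 5) (hinj : ∀ t, (C t).Injective)
    (hcov : ∀ y, 0 < y → y ≤ 5 * n + 2 → y ≠ 2 * n + 1 → y ≠ 4 * n + 2 →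
      ∃ t p, IsDiffOf (10 * n + 5) y (C t p) (C t (p + 1))) :
    IsBaseFamily fun t p => (C t p : ZMod (10 * n + 5)) := by
  refine ⟨fun t a b h => hinj t ?_, fun d => ?_⟩
  · rw [ZMod.natCast_eq_natCast_iff] at h
    exact h.eq_of_lt_of_lt (hlt _ _) (hlt _ _)
  · have key : ∀ y : ℕ, y ≤ 5 * n + 2 →
        (∃ t p, (y : ZMod (10 * n + 5)) = C t (p + 1) - C t p ∨
          (y : ZMod (10 * n + 5)) = -(C t (p + 1) - C t p)) ∨
        ∃ j, (y : ZMod (10 * n + 5)) = shortVertex n j := by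
      intro y hy
      by_cases h0 : y = 0
      · exact Or.inr ⟨0, by simp [h0, shortVertex]⟩
      by_cases h1 : y = 2 * n + 1
      · exact Or.inr ⟨1, by simp [h1, shortVertex]⟩
      by_cases h2 : y = 4 * n + 2
      · refine Or.inr ⟨2, ?_⟩
        rw [shortVertex, h2]
        congr 1
        change _ = 2 * _
        ring
      obtain ⟨t, p, h⟩ := hcov y (by lia) hy h1 h2
      exact Or.inl ⟨t, p, h.cast⟩
    have hd := ZMod.natCast_zmod_val d
    have hv := ZMod.val_lt d
    by_cases h : d.val ≤ 5 * n + 2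
    · have := key d.val h
      rwa [hd] at this
    · have h1 : ((10 * n + 5 - d.val : ℕ) : ZMod (10 * n + 5)) = -d := by
        rw [Nat.cast_sub hv.le, ZMod.natCast_self, hd, zero_sub]
      have := key (10 * n + 5 - d.val) (by lia)
      rw [h1] at this
      rcases this with ⟨t, p, h | h⟩ | ⟨j, h⟩
      · exact Or.inl ⟨t, p, Or.inr (by rw [← h, neg_neg])⟩
      · exact Or.inl ⟨t, p, Or.inl (neg_injective h)⟩
      · exact Or.inr ⟨-j, by rw [shortVertex_neg, ← h, neg_neg]⟩

/-- Base cycles `Q` whose differences are those left over by the cycles built from a Skolem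
sequence of order `N` and the pairs `{2 n + 1 + x, 4 n + 2 - x}` with `e < x`. -/
structure IsCompletion (n N e : ℕ) (Q : Fin e → Fin 5 → ℕ) : Prop where
  lt : ∀ t p, Q t p < 10 * n + 5
  inj : ∀ t, (Q t).Injective
  cover : ∀ y, (2 * N < y ∧ y ≤ 2 * n) ∨ (4 * n + 2 + N < y ∧ y ≤ 5 * n + 2) ∨
    (2 * n + 1 < y ∧ y ≤ 2 * n + 1 + e) ∨ (4 * n + 2 ≤ y + e ∧ y < 4 * n + 2) →
    ∃ t p, IsDiffOf (10 * n + 5) y (Q t p) (Q t (p + 1))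

lemma isCompletion_zero (n : ℕ) : IsCompletion n n 0 Fin.elim0 :=
  ⟨fun t => t.elim0, fun t => t.elim0, fun y hy => by lia⟩

lemma exists_isCompletion_two {n : ℕ} (hn : 8 ≤ n) : ∃ Q, IsCompletion n (n - 2) 2 Q := by
  refine ⟨![![0, 2 * n + 2, 8 * n + 6, 10 * n + 3, 5 * n + 2],
    ![0, 2 * n - 1, 4 * n - 3, 2 * n - 3, 8 * n + 2]], ?_, ?_, ?_⟩
  · intro t p
    fin_cases t <;> fin_cases p <;> simp <;> lia
  · intro t a b
    fin_cases t <;> fin_cases a <;> fin_cases b <;> simp <;> lia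
  · intro y hy
    rcases (by lia : y = 2 * n + 2 ∨ y = 4 * n + 1 ∨ y = 2 * n - 3 ∨ y = 5 * n + 1 ∨ y = 5 * n + 2 ∨
      y = 2 * n - 1 ∨ y = 2 * n - 2 ∨ y = 2 * n ∨ y = 4 * n ∨ y = 2 * n + 3)
      with h | h | h | h | h | h | h | h | h | h
    · exact ⟨0, 0, by simp [IsDiffOf]; lia⟩
    · exact ⟨0, 1, by simp [IsDiffOf]; lia⟩
    · exact ⟨0, 2, by simp [IsDiffOf]; lia⟩
    · exact ⟨0, 3, by simp [IsDiffOf]; lia⟩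
    · exact ⟨0, 4, by simp [IsDiffOf]; lia⟩
    · exact ⟨1, 0, by simp [IsDiffOf]; lia⟩
    · exact ⟨1, 1, by simp [IsDiffOf]; lia⟩
    · exact ⟨1, 2, by simp [IsDiffOf]; lia⟩
    · exact ⟨1, 3, by simp [IsDiffOf]; lia⟩
    · exact ⟨1, 4, by simp [IsDiffOf]; lia⟩

/-- The base cycles given by a Skolem sequence `f`, a permutation `π` matching the pairs of the
sequence with pairs of differences of constant sum, and a completion `Q`. -/
def skolemCycles (n : ℕ) {N e : ℕ} (f : ℕ → ℕ) (Q : Fin e → Fin 5 → ℕ)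
    (π : Equiv.Perm (Fin N)) : Fin N ⊕ Fin e → Fin 5 → ℕ
  | .inl t => ![0, 4 * n + 2 + (t + 1), 4 * n + 2 + (f (t + 1) + (t + 1)), 4 * n + 2,
      6 * n + 3 + (π t + 1 + e)]
  | .inr t => Q t

variable {n N e : ℕ} {f : ℕ → ℕ} {Q : Fin e → Fin 5 → ℕ}

lemma isBaseFamily_skolemCycles (hf : IsSkolem N f) (hne : N + e = n) (hQ : IsCompletion n N e Q)
    (π : Equiv.Perm (Fin N)) :
    IsBaseFamily fun t p => (skolemCycles n f Q π t p : ZMod (10 * n + 5)) := by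
  refine isBaseFamily_cast ?_ ?_ ?_
  · rintro (t | t) p
    · have h1 := hf.le (t + 1) (by lia) (by lia)
      have h2 := (π t).2
      fin_cases p <;> simp [skolemCycles] <;> lia
    · exact hQ.lt t p
  · rintro (t | t) a b
    · have h0 := hf.pos (t + 1) (by lia) (by lia)
      have h1 := hf.le (t + 1) (by lia) (by lia)
      have h2 := (π t).2
      fin_cases a <;> fin_cases b <;> simp [skolemCycles] <;> lia
    · exact fun h => hQ.inj t h
  · intro y h0 h1 h2 h3
    by_cases hy : (2 * N < y ∧ y ≤ 2 * n) ∨ (4 * n + 2 + N < y ∧ y ≤ 5 * n + 2) ∨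
      (2 * n + 1 < y ∧ y ≤ 2 * n + 1 + e) ∨ (4 * n + 2 ≤ y + e ∧ y < 4 * n + 2)
    · obtain ⟨t, p, h⟩ := hQ.cover y hy
      exact ⟨.inr t, p, h⟩
    have hπ : ∀ x, e < x → x ≤ n → ∃ t, (π t : ℕ) + 1 + e = x := by
      intro x hx1 hx2
      refine ⟨π.symm ⟨x - 1 - e, by lia⟩, ?_⟩
      rw [Equiv.apply_symm_apply]
      simp only
      lia
    rcases (by lia : y ≤ 2 * N ∨ (4 * n + 2 < y ∧ y ≤ 4 * n + 2 + N) ∨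
      (2 * n + 1 + e < y ∧ y ≤ 3 * n + 1) ∨ (3 * n + 1 < y ∧ y + e < 4 * n + 2)) with h | h | h | h
    · obtain ⟨k, hk1, hk2, hk | hk⟩ := hf.cover y h0 h
      · refine ⟨.inl ⟨k - 1, by lia⟩, 1, ?_⟩
        have hk' : k - 1 + 1 = k := by lia
        simp [skolemCycles, IsDiffOf, hk']
        lia
      · refine ⟨.inl ⟨k - 1, by lia⟩, 2, ?_⟩
        have hk' : k - 1 + 1 = k := by lia
        simp [skolemCycles, IsDiffOf, hk']
        lia
    · refine ⟨.inl ⟨y - (4 * n + 2) - 1, by lia⟩, 0, ?_⟩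
      simp [skolemCycles, IsDiffOf]
      lia
    · obtain ⟨t, ht⟩ := hπ (y - (2 * n + 1)) (by lia) (by lia)
      refine ⟨.inl t, 3, ?_⟩
      simp [skolemCycles, IsDiffOf]
      lia
    · obtain ⟨t, ht⟩ := hπ (4 * n + 2 - y) (by lia) (by lia)
      refine ⟨.inl t, 4, ?_⟩
      simp [skolemCycles, IsDiffOf]
      lia

/-- Distinct permutations give distinct cyclic designs. -/
lemma factorial_le_card_cyclicDesign (hf : IsSkolem N f) (hne : N + e = n)
    (hQ : IsCompletion n N e Q) :
    N.factorial ≤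
      Nat.card {B : Set (Block (10 * n + 5)) // IsCyclicDesign (10 * n + 5) 5 B} := by
  have hfam := isBaseFamily_skolemCycles hf hne hQ
  have hdes := fun π => (hfam π).isCyclicDesign (by simpa using hne)
  calc N.factorial = Nat.card (Equiv.Perm (Fin N)) := by
        rw [Nat.card_eq_fintype_card, Fintype.card_perm, Fintype.card_fin]
    _ ≤ _ := Nat.card_le_card_of_injective (fun π => ⟨_, hdes π⟩) ?_
  intro π π' h
  have hB : develop (fun t p => (skolemCycles n f Q π t p : ZMod (10 * n + 5))) =
      develop fun t p => (skolemCycles n f Q π' t p : ZMod (10 * n + 5)) := Subtype.ext_iff.mp h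
  ext t
  have hmem : ∀ π : Equiv.Perm (Fin N),
      edgesOf (fun p => (skolemCycles n f Q π (.inl t) p : ZMod (10 * n + 5))) ∈
        develop fun t p => (skolemCycles n f Q π t p : ZMod (10 * n + 5)) :=
    fun π => Or.inl ⟨.inl t, 0, by simp⟩
  have heq := (hdes π).1.eq_of_mem ((hfam π).inj (.inl t)) ((hfam π').inj (.inl t)) (hmem π)
    (by rw [hB]; exact hmem π') (by simp [skolemCycles]) (by simp [skolemCycles])
  have hval : ∀ π : Equiv.Perm (Fin N),
      skolemCycles n f Q π (.inl t) 4 = 6 * n + 3 + (π t + 1 + e) := fun _ => rfl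
  have h4 : ((6 * n + 3 + (π t + 1 + e) : ℕ) : ZMod (10 * n + 5)) =
      ((6 * n + 3 + (π' t + 1 + e) : ℕ) : ZMod (10 * n + 5)) := by
    rw [← hval, ← hval]
    exact congrFun heq 4
  rw [ZMod.natCast_eq_natCast_iff] at h4
  have h2 := (π t).2
  have h2' := (π' t).2
  have h5 := h4.eq_of_lt_of_lt (by omega) (by omega)
  omega

/-- There are at least `(n - 2)!` cyclic designs of order `10 n + 5`. -/
lemma factorial_sub_two_le_card_cyclicDesign (hn : 10 ≤ n) :
    (n - 2).factorial ≤
      Nat.card {B : Set (Block (10 * n + 5)) // IsCyclicDesign (10 * n + 5) 5 B} := by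
  by_cases h : n % 4 = 0 ∨ n % 4 = 1
  · obtain ⟨f, hf⟩ := exists_isSkolem (by lia) h
    exact (Nat.factorial_le (by lia)).trans
      (factorial_le_card_cyclicDesign hf (by lia) (isCompletion_zero n))
  · obtain ⟨f, hf⟩ := exists_isSkolem (N := n - 2) (by lia) (by lia)
    obtain ⟨Q, hQ⟩ := exists_isCompletion_two (n := n) (by lia)
    exact factorial_le_card_cyclicDesign hf (by lia) hQ

end Construction

lemma two_pow_mul_lt_three_pow {k : ℕ} (hk : 30 ≤ k) : 2 ^ k * (80 * k + 85) < 3 ^ k := by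
  induction k, hk using Nat.le_induction with
  | base => norm_num
  | succ k hk ih =>
    calc 2 ^ (k + 1) * (80 * (k + 1) + 85) = 2 ^ k * (2 * (80 * k + 165)) := by ring
      _ ≤ 2 ^ k * (3 * (80 * k + 85)) := Nat.mul_le_mul_left _ (by lia)
      _ = 3 * (2 ^ k * (80 * k + 85)) := by ring
      _ < 3 * 3 ^ k := by lia
      _ = 3 ^ (k + 1) := by ring

lemma pow_mul_thirty_pow_le_factorial {n : ℕ} (hn : 4800 ≤ n) :
    (10 * n + 5) ^ (n / 8 + 1) * 30 ^ n ≤ (n - 2).factorial := by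
  set k := n / 8 with hk
  have hk' : 600 ≤ k := by lia
  calc (10 * n + 5) ^ (k + 1) * 30 ^ n ≤ (85 * (k + 1)) ^ (k + 1) * 30 ^ (8 * (k + 1)) := by
        gcongr
        · lia
        · norm_num
        · lia
    _ = (k + 1) ^ (k + 1) * (85 * 30 ^ 8) ^ (k + 1) := by
        rw [pow_mul, mul_pow, mul_pow]
        ring
    _ ≤ (k + 1) ^ (k + 1) * ((k + 1) ^ 5) ^ (k + 1) := by
        gcongr
        calc 85 * 30 ^ 8 ≤ 600 ^ 5 := by norm_num
          _ ≤ (k + 1) ^ 5 := by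
            gcongr
            lia
    _ = (k + 1) ^ (6 * (k + 1)) := by
        rw [← pow_mul, ← pow_add]
        congr 1
        ring
    _ ≤ (k + 1) ^ (n - 2 - k) := Nat.pow_le_pow_right (by lia) (by lia)
    _ ≤ k.factorial * (k + 1) ^ (n - 2 - k) := Nat.le_mul_of_pos_left _ k.factorial_pos
    _ ≤ (k + (n - 2 - k)).factorial := Nat.factorial_mul_pow_le_factorial
    _ = (n - 2).factorial := by
        congr 1
        lia

lemma thirty_pow_le_NC {n : ℕ} (hn : 4800 ≤ n) : 30 ^ n ≤ NC (10 * n + 5) 5 := by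
  have hk : 2 ^ (n / 8) * (10 * n + 5) < 3 ^ (n / 8) :=
    (Nat.mul_le_mul_left _ (by lia)).trans_lt (two_pow_mul_lt_three_pow (k := n / 8) (by lia))
  have h := (pow_mul_thirty_pow_le_factorial hn).trans
    ((factorial_sub_two_le_card_cyclicDesign (by lia)).trans (card_cyclicDesign_le hk))
  exact Nat.le_of_mul_le_mul_left h (by positivity)

end CCS

/-- For all sufficiently large `n` not congruent to
`3, 5, 24, 26 (mod 28)`, `NC(10n+5, 5) ≥ 29.7^n`. -/
theorem stmt12 : ∃ N : ℕ, ∀ n : ℕ, N ≤ n →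
    ¬(n % 28 = 3 ∨ n % 28 = 5 ∨ n % 28 = 24 ∨ n % 28 = 26) →
    (29.7 : ℝ) ^ n ≤ (CCS.NC (10 * n + 5) 5 : ℝ) := by
  refine ⟨4800, fun n hn _ => ?_⟩
  calc (29.7 : ℝ) ^ n ≤ 30 ^ n := by
        gcongr
        norm_num
    _ ≤ (CCS.NC (10 * n + 5) 5 : ℝ) := by exact_mod_cast CCS.thirty_pow_le_NC hn
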